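/- arXiv:2406.01799 — 6 statements merged into one kernel-verified Lean document; each statement's English description precedes it below -/
import Mathlib

section
/- Let X ⊂ ℝ^n be a convex compact set, let ‖·‖ be a norm on ℝ^n with dual norm ‖y‖_* := sup_{‖z‖≤1} ⟨y,z⟩, and let R : X → ℝ be differentiable and 1-strongly convex with respect to ‖·‖ (i.e., R(z') ≥ R(z) + ⟨∇R(z), z'−z⟩ + (1/2)‖z'−z‖² for all z,z' ∈ X). For y₁, y₂ ∈ ℝ^n let w_i be a minimizer over X of z ↦ ⟨y_i, z⟩ + R(z), for i ∈ {1,2}. Then ‖w₁ − w₂‖ ≤ ‖y₁ − y₂‖_*. -/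
open Finset

theorem aux_bound_core {E : Type*} [NormedAddCommGroup E] [NormedSpace ℝ E]
    [FiniteDimensional ℝ E] (f : E →ₗ[ℝ] ℝ) : ∃ C : ℝ, ∀ x, ‖x‖ ≤ 1 → f x ≤ C := by
  refine ⟨‖LinearMap.toContinuousLinearMap f‖, fun x hx => ?_⟩
  have h := (LinearMap.toContinuousLinearMap f).le_opNorm x
  have h2 : f x ≤ ‖f x‖ := Real.le_norm_self _
  have h3 : ‖f x‖ ≤ ‖LinearMap.toContinuousLinearMap f‖ * ‖x‖ := h
  nlinarith [norm_nonneg (LinearMap.toContinuousLinearMap f)]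

theorem aux_nonneg {E : Type*} [AddCommGroup E] [Module ℝ E] (N : E → ℝ)
    (hN_zero : ∀ x, N x = 0 ↔ x = 0)
    (hN_smul : ∀ (a : ℝ) (x : E), N (a • x) = |a| * N x)
    (hN_add : ∀ x y : E, N (x + y) ≤ N x + N y) (x : E) : 0 ≤ N x := by
  have h := hN_add x ((-1 : ℝ) • x)
  rw [hN_smul] at h
  have h0 : x + (-1 : ℝ) • x = 0 := by simp
  rw [h0, (hN_zero 0).2 rfl] at h
  norm_num at h
  linarith

theorem aux_bound {E : Type*} [AddCommGroup E] [Module ℝ E]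
    [FiniteDimensional ℝ E] (N : E → ℝ)
    (hN_zero : ∀ x, N x = 0 ↔ x = 0)
    (hN_smul : ∀ (a : ℝ) (x : E), N (a • x) = |a| * N x)
    (hN_add : ∀ x y : E, N (x + y) ≤ N x + N y)
    (f : E →ₗ[ℝ] ℝ) : ∃ C : ℝ, ∀ x, N x ≤ 1 → f x ≤ C := by
  letI : Norm E := ⟨N⟩
  have core : NormedSpace.Core ℝ E :=
    { norm_nonneg := aux_nonneg N hN_zero hN_smul hN_add
      norm_smul := hN_smul
      norm_triangle := hN_add
      norm_eq_zero_iff := hN_zero }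
  letI : NormedAddCommGroup E := NormedAddCommGroup.ofCore core
  letI : NormedSpace ℝ E := NormedSpace.ofCore core
  exact aux_bound_core f

/-- Quadratic growth at a minimizer; `L` is the linear term. -/
theorem aux_growth {E : Type*} [AddCommGroup E] [Module ℝ E] (X : Set E) (hX : Convex ℝ X)
    (N : E → ℝ) (hN_smul : ∀ (a : ℝ) (x : E), N (a • x) = |a| * N x)
    (R : E → ℝ) (G : E → E →ₗ[ℝ] ℝ)
    (hs : ∀ z ∈ X, ∀ z' ∈ X, R z + G z (z' - z) + (1 / 2) * N (z' - z) ^ 2 ≤ R z')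
    (L : E →ₗ[ℝ] ℝ) (w v : E) (hw : w ∈ X) (hv : v ∈ X)
    (hmin : ∀ z ∈ X, L w + R w ≤ L z + R z) :
    (1 / 2) * N (v - w) ^ 2 ≤ L (v - w) + R v - R w := by
  have key : ∀ t : ℝ, 0 < t → t < 1 →
      (1 - t) * ((1 / 2) * N (v - w) ^ 2) ≤ L (v - w) + R v - R w := by
    intro t h0 h1
    have hm : w + t • (v - w) ∈ X := hX.add_smul_sub_mem hw hv ⟨h0.le, h1.le⟩
    have e1 : w - (w + t • (v - w)) = (-t) • (v - w) := by module
    have e2 : v - (w + t • (v - w)) = (1 - t) • (v - w) := by module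
    have a1 := hs _ hm _ hw
    have a2 := hs _ hm _ hv
    have a3 := hmin _ hm
    rw [e1, hN_smul, mul_pow, sq_abs, map_smul, smul_eq_mul] at a1
    rw [e2, hN_smul, mul_pow, sq_abs, map_smul, smul_eq_mul] at a2
    rw [map_add, map_smul, smul_eq_mul] at a3
    have b1 := mul_le_mul_of_nonneg_left a1 (by linarith : (0:ℝ) ≤ 1 - t)
    have b2 := mul_le_mul_of_nonneg_left a2 h0.le
    refine le_of_mul_le_mul_left ?_ h0
    nlinarith
  by_contra! hc
  set A := (1 / 2) * N (v - w) ^ 2 with hA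
  set B := L (v - w) + R v - R w
  have hA0 : 0 ≤ A := by positivity
  have hh := key (1 / 2) (by norm_num) (by norm_num)
  have hB : 0 ≤ B := by linarith
  have hApos : 0 < A := by linarith
  have hk := key ((A - B) / (2 * A)) (by apply div_pos <;> linarith)
    (by rw [div_lt_one (by linarith)]; linarith)
  have : (1 - (A - B) / (2 * A)) * A = (A + B) / 2 := by field_simp; ring
  linarith

/-- Stability of regularized linear minimization (the key step in the analysis of lazy
mirror descent).  Let `X ⊆ ℝ^n` be convex and compact, let `N` be a norm on `ℝ^n`, and
let `R` be differentiable and 1-strongly convex with respect to `N` on `X`.  If `w₁, w₂`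
minimize `z ↦ ⟨y₁, z⟩ + R(z)` resp. `z ↦ ⟨y₂, z⟩ + R(z)` over `X`, then
`N(w₁ − w₂) ≤ ‖y₁ − y₂‖_*`, where `‖y‖_* = sup_{N(z) ≤ 1} ⟨y, z⟩` is the dual norm. -/
theorem regularized_argmin_stability (n : ℕ) (X : Set (EuclideanSpace ℝ (Fin n)))
    (hXconv : Convex ℝ X) (hXcomp : IsCompact X)
    (N : EuclideanSpace ℝ (Fin n) → ℝ)
    (hN_zero : ∀ x, N x = 0 ↔ x = 0)
    (hN_smul : ∀ (a : ℝ) (x : EuclideanSpace ℝ (Fin n)), N (a • x) = |a| * N x)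
    (hN_add : ∀ x y : EuclideanSpace ℝ (Fin n), N (x + y) ≤ N x + N y)
    (R : EuclideanSpace ℝ (Fin n) → ℝ)
    (gradR : EuclideanSpace ℝ (Fin n) → EuclideanSpace ℝ (Fin n))
    (hdiff : ∀ z ∈ X, HasGradientAt R (gradR z) z)
    (hstrong : ∀ z ∈ X, ∀ z' ∈ X,
      R z + (∑ i, gradR z i * (z' - z) i) + (1 / 2) * N (z' - z) ^ 2 ≤ R z')
    (y₁ y₂ w₁ w₂ : EuclideanSpace ℝ (Fin n))
    (hw₁ : w₁ ∈ X ∧ ∀ z ∈ X, (∑ i, y₁ i * w₁ i) + R w₁ ≤ (∑ i, y₁ i * z i) + R z)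
    (hw₂ : w₂ ∈ X ∧ ∀ z ∈ X, (∑ i, y₂ i * w₂ i) + R w₂ ≤ (∑ i, y₂ i * z i) + R z) :
    N (w₁ - w₂) ≤
      sSup ((fun z : EuclideanSpace ℝ (Fin n) => ∑ i, (y₁ - y₂) i * z i) ''
        {z | N z ≤ 1}) := by
  let L : EuclideanSpace ℝ (Fin n) → EuclideanSpace ℝ (Fin n) →ₗ[ℝ] ℝ := fun y =>
    { toFun := fun z => ∑ i, y i * z i
      map_add' := by intro a b; simp [mul_add, Finset.sum_add_distrib]
      map_smul' := by
        intro a b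
        simp only [PiLp.smul_apply, smul_eq_mul, RingHom.id_apply, Finset.mul_sum]
        exact Finset.sum_congr rfl fun i _ => by ring }
  have g1 := aux_growth X hXconv N hN_smul R (fun z => L (gradR z)) hstrong (L y₁) w₁ w₂
    hw₁.1 hw₂.1 hw₁.2
  have g2 := aux_growth X hXconv N hN_smul R (fun z => L (gradR z)) hstrong (L y₂) w₂ w₁
    hw₂.1 hw₁.1 hw₂.2
  have hsub : ∀ z, L (y₁ - y₂) z = L y₁ z - L y₂ z := by
    intro z
    simp [L, sub_mul, Finset.sum_sub_distrib]
  have hneg : N (w₁ - w₂) = N (w₂ - w₁) := by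
    have := hN_smul (-1) (w₂ - w₁)
    simpa using this
  have hneg2 : L y₂ (w₁ - w₂) = - L y₂ (w₂ - w₁) := by
    rw [← map_neg, neg_sub]
  have hD : N (w₂ - w₁) ^ 2 ≤ L (y₁ - y₂) (w₂ - w₁) := by
    rw [hsub]
    rw [hneg, hneg2] at g2
    linarith
  obtain ⟨C, hC⟩ := aux_bound N hN_zero hN_smul hN_add (L (y₁ - y₂))
  have hbdd : BddAbove ((fun z : EuclideanSpace ℝ (Fin n) => ∑ i, (y₁ - y₂) i * z i) ''
        {z | N z ≤ 1}) := by
    refine ⟨C, ?_⟩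
    rintro _ ⟨z, hz, rfl⟩
    exact hC z hz
  have hle : ∀ z, N z ≤ 1 → L (y₁ - y₂) z ≤
      sSup ((fun z : EuclideanSpace ℝ (Fin n) => ∑ i, (y₁ - y₂) i * z i) '' {z | N z ≤ 1}) :=
    fun z hz => le_csSup hbdd ⟨z, hz, rfl⟩
  have hnn := aux_nonneg N hN_zero hN_smul hN_add (w₂ - w₁)
  rw [hneg]
  rcases hnn.eq_or_lt with h | h
  · rw [← h]
    have := hle 0 (by rw [(hN_zero 0).2 rfl]; norm_num)
    rwa [map_zero] at this
  · refine le_trans ?_ (hle ((N (w₂ - w₁))⁻¹ • (w₂ - w₁)) ?_)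
    · rw [map_smul, smul_eq_mul, inv_mul_eq_div, le_div_iff₀ h]
      linarith [sq (N (w₂ - w₁))]
    · rw [hN_smul, abs_of_pos (inv_pos.2 h), inv_mul_cancel₀ h.ne']
end

section
/- Let X ⊂ ℝ^n be convex and compact, ‖·‖ a norm on ℝ^n, R : X → ℝ differentiable and 1-strongly convex with respect to ‖·‖, and ρ := max_{z∈X} R(z) − min_{z∈X} R(z). Let ℓ_1,…,ℓ_T : X → ℝ be convex, differentiable, and L-Lipschitz with respect to ‖·‖. Set η := √ρ/(L√(2T)) and define iterates z_t := argmin_{z∈X} [ ∑_{s=1}^{t−1} ⟨z, ∇ℓ_s(z_s)⟩ + R(z)/η ]. Then (i) ∑_{t=1}^T ℓ_t(z_t) − min_{z∈X} ∑_{t=1}^T ℓ_t(z) ≤ L√(8ρT), and (ii) for each t ∈ [T−1], ‖z_t − z_{t+1}‖ ≤ √(ρ/(2T)). -/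
open Finset

lemma lmd_deriv_le {φ : ℝ → ℝ} {d C : ℝ} (h : HasDerivAt φ d 0)
    (hC : ∀ s : ℝ, 0 < s → s < 1 → φ s - φ 0 ≤ s * C) : d ≤ C := by
  have h1 := h.tendsto_slope_zero_right
  refine le_of_tendsto h1 ?_
  filter_upwards [Ioo_mem_nhdsGT (show (0:ℝ) < 1 by norm_num)] with s hs
  have := hC s hs.1 hs.2
  rw [zero_add, smul_eq_mul, inv_mul_le_iff₀ hs.1]
  exact this

lemma lmd_hasDerivAt {n : ℕ} {f : EuclideanSpace ℝ (Fin n) → ℝ} {g x : EuclideanSpace ℝ (Fin n)}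
    (h : HasGradientAt f g x) (v : EuclideanSpace ℝ (Fin n)) :
    HasDerivAt (fun s : ℝ => f (x + s • v)) (∑ i, v i * g i) 0 := by
  have h1 : HasDerivAt (fun s : ℝ => x + s • v) v 0 := by
    simpa using ((hasDerivAt_id (0:ℝ)).smul_const v).const_add x
  have h2 : HasFDerivAt f ((InnerProductSpace.toDual ℝ _) g) (x + (0:ℝ) • v) := by
    simpa using h.hasFDerivAt
  have h3 := h2.comp_hasDerivAt (0:ℝ) h1
  have e : ((InnerProductSpace.toDual ℝ (EuclideanSpace ℝ (Fin n))) g) v = ∑ i, v i * g i := by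
    simp [PiLp.inner_apply]
  rw [e] at h3
  exact h3

lemma lmd_le_of_forall {a b : ℝ} (h : ∀ s : ℝ, 0 < s → s < 1 → (1 - s) * b ≤ a) : b ≤ a := by
  have h1 : Filter.Tendsto (fun s : ℝ => (1 - s) * b) (nhdsWithin 0 (Set.Ioi 0)) (nhds b) := by
    have : Continuous (fun s : ℝ => (1 - s) * b) := by fun_prop
    have := this.tendsto 0
    simp only [sub_zero, one_mul] at this
    exact this.mono_left nhdsWithin_le_nhds
  refine le_of_tendsto h1 ?_
  filter_upwards [Ioo_mem_nhdsGT (show (0:ℝ) < 1 by norm_num)] with s hs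
  exact h s hs.1 hs.2


/-- Lazy Mirror Descent (Follow-the-Regularized-Leader).  Let `X ⊆ ℝ^n` be convex and
compact, `N` a norm, `R` differentiable and 1-strongly convex with respect to `N`, and
`ρ = max_X R − min_X R`.  Let `ℓ_1, …, ℓ_T` be convex, differentiable, `L`-Lipschitz
losses, `η = √ρ/(L√(2T))`, and let
`z_t = argmin_{z ∈ X} [∑_{s=1}^{t−1} ⟨z, ∇ℓ_s(z_s)⟩ + R(z)/η]`.
Then (i) `∑_t ℓ_t(z_t) − min_{z ∈ X} ∑_t ℓ_t(z) ≤ L√(8ρT)`, and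
(ii) `N(z_t − z_{t+1}) ≤ √(ρ/(2T))` for `t ∈ [T−1]`. -/
theorem lazy_mirror_descent_regret (n T : ℕ) (hT : 0 < T)
    (X : Set (EuclideanSpace ℝ (Fin n)))
    (hXconv : Convex ℝ X) (hXcomp : IsCompact X)
    (N : EuclideanSpace ℝ (Fin n) → ℝ)
    (hN_zero : ∀ x, N x = 0 ↔ x = 0)
    (hN_smul : ∀ (a : ℝ) (x : EuclideanSpace ℝ (Fin n)), N (a • x) = |a| * N x)
    (hN_add : ∀ x y : EuclideanSpace ℝ (Fin n), N (x + y) ≤ N x + N y)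
    (R : EuclideanSpace ℝ (Fin n) → ℝ)
    (gradR : EuclideanSpace ℝ (Fin n) → EuclideanSpace ℝ (Fin n))
    (hRdiff : ∀ z ∈ X, HasGradientAt R (gradR z) z)
    (hRstrong : ∀ z ∈ X, ∀ z' ∈ X,
      R z + (∑ i, gradR z i * (z' - z) i) + (1 / 2) * N (z' - z) ^ 2 ≤ R z')
    (ρ : ℝ) (hρ : ρ = sSup (R '' X) - sInf (R '' X))
    (L : ℝ) (hL : 0 < L)
    (ℓ : ℕ → EuclideanSpace ℝ (Fin n) → ℝ)
    (gradℓ : ℕ → EuclideanSpace ℝ (Fin n) → EuclideanSpace ℝ (Fin n))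
    (hℓdiff : ∀ t ∈ Finset.Icc 1 T, ∀ z ∈ X, HasGradientAt (ℓ t) (gradℓ t z) z)
    (hℓconv : ∀ t ∈ Finset.Icc 1 T, ConvexOn ℝ X (ℓ t))
    (hℓlip : ∀ t ∈ Finset.Icc 1 T, ∀ z ∈ X, ∀ z' ∈ X, |ℓ t z - ℓ t z'| ≤ L * N (z - z'))
    (η : ℝ) (hη : η = Real.sqrt ρ / (L * Real.sqrt (2 * T)))
    (z : ℕ → EuclideanSpace ℝ (Fin n))
    (hz : ∀ t ∈ Finset.Icc 1 T, z t ∈ X ∧ ∀ y ∈ X,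
      (∑ s ∈ Finset.Icc 1 (t - 1), ∑ i, z t i * gradℓ s (z s) i) + R (z t) / η ≤
        (∑ s ∈ Finset.Icc 1 (t - 1), ∑ i, y i * gradℓ s (z s) i) + R y / η) :
    (∀ y ∈ X,
        (∑ t ∈ Finset.Icc 1 T, ℓ t (z t)) - ∑ t ∈ Finset.Icc 1 T, ℓ t y ≤
          L * Real.sqrt (8 * ρ * T)) ∧
      ∀ t ∈ Finset.Icc 1 (T - 1), N (z t - z (t + 1)) ≤ Real.sqrt (ρ / (2 * T)) := by
  have hlin_sub : ∀ (g a b : EuclideanSpace ℝ (Fin n)),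
      ∑ i, (a - b) i * g i = ∑ i, a i * g i - ∑ i, b i * g i := by
    intro g a b
    simp [sub_mul, Finset.sum_sub_distrib]
  have hN0 : N 0 = 0 := (hN_zero 0).2 rfl
  have hNneg : ∀ x, N (-x) = N x := by
    intro x
    have := hN_smul (-1) x
    simpa using this
  have hNnn : ∀ x, 0 ≤ N x := by
    intro x
    have := hN_add x (-x)
    rw [add_neg_cancel, hN0, hNneg] at this
    linarith
  have hseg : ∀ x ∈ X, ∀ y ∈ X, ∀ s : ℝ, 0 < s → s < 1 → x + s • (y - x) ∈ X := by
    intro x hx y hy s h0 h1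
    exact hXconv.add_smul_sub_mem hx hy ⟨h0.le, h1.le⟩
  -- Jensen form of strong convexity
  have hJ : ∀ x ∈ X, ∀ y ∈ X, ∀ s : ℝ, 0 < s → s < 1 →
      R (x + s • (y - x)) + s * (1 - s) * (N (y - x) ^ 2 / 2) ≤ s * R y + (1 - s) * R x := by
    intro x hx y hy s h0 h1
    have hw := hseg x hx y hy s h0 h1
    have a1 := hRstrong _ hw y hy
    have a2 := hRstrong _ hw x hx
    have e1 : y - (x + s • (y - x)) = (1 - s) • (y - x) := by module
    have e2 : x - (x + s • (y - x)) = (-s) • (y - x) := by module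
    rw [e1, hN_smul, abs_of_pos (by linarith)] at a1
    rw [e2, hN_smul, abs_neg, abs_of_pos h0] at a2
    set w := x + s • (y - x)
    have f : ∀ c : ℝ, ∑ i, gradR w i * (c • (y - x)) i = c * ∑ i, gradR w i * (y - x) i := by
      intro c
      rw [Finset.mul_sum]
      refine Finset.sum_congr rfl fun i _ => ?_
      simp only [PiLp.smul_apply, smul_eq_mul]; ring
    rw [f] at a1 a2
    set D := ∑ i, gradR w i * (y - x) i
    have b1 := mul_le_mul_of_nonneg_left a1 h0.le
    have b2 := mul_le_mul_of_nonneg_left a2 (show 0 ≤ 1 - s by linarith)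
    nlinarith
  have h1T : 1 ∈ Finset.Icc 1 T := Finset.mem_Icc.2 ⟨le_rfl, hT⟩
  have hRc : ContinuousOn R X := fun x hx => (hRdiff x hx).continuousAt.continuousWithinAt
  have hcomp := hXcomp.image_of_continuousOn hRc
  have hRle : ∀ x ∈ X, ∀ y ∈ X, R x - R y ≤ ρ := by
    intro x hx y hy
    have := le_csSup hcomp.bddAbove (Set.mem_image_of_mem R hx)
    have := csInf_le hcomp.bddBelow (Set.mem_image_of_mem R hy)
    linarith
  have hρ0 : 0 ≤ ρ := by
    have := hRle _ (hz 1 h1T).1 _ (hz 1 h1T).1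
    linarith
  have hTr : (0:ℝ) < T := by exact_mod_cast hT
  rcases hρ0.eq_or_lt with h0 | hpos
  · -- degenerate case
    have hsing : ∀ x ∈ X, ∀ y ∈ X, x = y := by
      intro x hx y hy
      have hw := hseg x hx y hy (1/2) (by norm_num) (by norm_num)
      have a := hJ x hx y hy (1/2) (by norm_num) (by norm_num)
      have b1 := hRle x hx _ hw
      have b2 := hRle y hy _ hw
      have : N (y - x) ^ 2 ≤ 0 := by linarith
      have : N (y - x) = 0 := by
        have := hNnn (y - x)
        nlinarith
      exact (sub_eq_zero.1 ((hN_zero _).1 this)).symm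
    constructor
    · intro y hy
      have : ∑ t ∈ Finset.Icc 1 T, ℓ t (z t) = ∑ t ∈ Finset.Icc 1 T, ℓ t y :=
        Finset.sum_congr rfl fun t ht => by rw [hsing _ (hz t ht).1 y hy]
      rw [this, sub_self]
      positivity
    · intro t ht
      rw [Finset.mem_Icc] at ht
      rw [hsing _ (hz t (Finset.mem_Icc.2 ⟨ht.1, by omega⟩)).1 _
        (hz (t+1) (Finset.mem_Icc.2 ⟨by omega, by omega⟩)).1, sub_self, hN0]
      positivity
  have hηpos : 0 < η := by rw [hη]; positivity
  -- linear functional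
  set G : ℕ → EuclideanSpace ℝ (Fin n) → ℝ := fun s y => ∑ i, y i * gradℓ s (z s) i with hG
  set F : ℕ → EuclideanSpace ℝ (Fin n) → ℝ :=
    fun t y => ∑ s ∈ Finset.Icc 1 (t - 1), G s y + R y / η with hF
  have hGseg : ∀ r x y (s : ℝ), G r (x + s • (y - x)) = G r x + s * (G r y - G r x) := by
    intro r x y s
    simp only [hG, ← Finset.sum_sub_distrib, Finset.mul_sum, ← Finset.sum_add_distrib]
    refine Finset.sum_congr rfl fun i _ => ?_
    simp only [PiLp.add_apply, PiLp.smul_apply, PiLp.sub_apply, smul_eq_mul]; ring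
  have hmin : ∀ t ∈ Finset.Icc 1 T, ∀ y ∈ X, F t (z t) ≤ F t y := fun t ht => (hz t ht).2
  have hstep : ∀ t, 1 ≤ t → ∀ y, F (t + 1) y = F t y + G t y := by
    intro t ht y
    obtain ⟨k, rfl⟩ : ∃ k, t = k + 1 := ⟨t - 1, by omega⟩
    simp only [hF, Nat.add_sub_cancel]
    rw [Finset.sum_Icc_succ_top (by omega)]
    ring
  have hgrow : ∀ t ∈ Finset.Icc 1 T, ∀ y ∈ X,
      F t (z t) + N (y - z t) ^ 2 / 2 / η ≤ F t y := by
    intro t ht y hy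
    have hzt := (hz t ht).1
    suffices N (y - z t) ^ 2 / 2 / η ≤ F t y - F t (z t) by linarith
    apply lmd_le_of_forall
    intro s h0 h1
    have a := hmin t ht _ (hseg _ hzt y hy s h0 h1)
    have b := div_le_div_of_nonneg_right (hJ _ hzt y hy s h0 h1) hηpos.le
    have c : ∑ r ∈ Finset.Icc 1 (t - 1), G r (z t + s • (y - z t))
        = ∑ r ∈ Finset.Icc 1 (t - 1), G r (z t) + s * (∑ r ∈ Finset.Icc 1 (t - 1), G r y
          - ∑ r ∈ Finset.Icc 1 (t - 1), G r (z t)) := by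
      rw [← Finset.sum_sub_distrib, Finset.mul_sum, ← Finset.sum_add_distrib]
      exact Finset.sum_congr rfl fun r _ => hGseg r _ _ s
    simp only [hF] at a ⊢
    rw [c] at a
    refine le_of_mul_le_mul_left ?_ h0
    have e1 : (R (z t + s • (y - z t)) + s * (1 - s) * (N (y - z t) ^ 2 / 2)) / η
      = R (z t + s • (y - z t)) / η + s * ((1 - s) * (N (y - z t) ^ 2 / 2 / η)) := by ring
    have e2 : (s * R y + (1 - s) * R (z t)) / η = s * (R y / η) + (1 - s) * (R (z t) / η) := by
      ring
    rw [e1, e2] at b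
    linarith
  have hGlip : ∀ t ∈ Finset.Icc 1 T, ∀ y ∈ X, G t (z t) - G t y ≤ L * N (y - z t) := by
    intro t ht y hy
    have hzt := (hz t ht).1
    have d := (lmd_hasDerivAt (hℓdiff t ht _ hzt) (y - z t)).neg
    rw [hlin_sub] at d
    have := lmd_deriv_le (C := L * N (y - z t)) d ?_
    · simp only [hG]; linarith
    intro s h0 h1
    have a := hℓlip t ht _ (hseg _ hzt y hy s h0 h1) _ hzt
    rw [add_sub_cancel_left, hN_smul, abs_of_pos h0] at a
    have := (abs_le.1 a).1
    simp only [Pi.neg_apply, zero_smul, add_zero]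
    linarith
  have hGconv : ∀ t ∈ Finset.Icc 1 T, ∀ y ∈ X, ℓ t (z t) - ℓ t y ≤ G t (z t) - G t y := by
    intro t ht y hy
    have hzt := (hz t ht).1
    have d := lmd_hasDerivAt (hℓdiff t ht _ hzt) (y - z t)
    rw [hlin_sub] at d
    have := lmd_deriv_le (C := ℓ t y - ℓ t (z t)) d ?_
    · simp only [hG]; linarith
    intro s h0 h1
    have a := (hℓconv t ht).2 hzt hy (show 0 ≤ 1 - s by linarith) h0.le (by ring)
    have e : (1 - s) • z t + s • y = z t + s • (y - z t) := by module
    rw [e] at a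
    simp only [smul_eq_mul] at a
    simp only [zero_smul, add_zero]
    linarith
  have hquad : ∀ u : ℝ, L * u - η * L ^ 2 / 2 ≤ u ^ 2 / 2 / η := by
    intro u
    rw [div_div, le_div_iff₀ (by positivity)]
    nlinarith [sq_nonneg (u - η * L)]
  have hnext : ∀ t ∈ Finset.Icc 1 T, ∀ y ∈ X,
      F t (z t) + G t (z t) - η * L ^ 2 / 2 ≤ F (t + 1) y := by
    intro t ht y hy
    rw [hstep t (Finset.mem_Icc.1 ht).1]
    have := hgrow t ht y hy
    have := hGlip t ht y hy
    have := hquad (N (y - z t))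
    linarith
  have hind : ∀ k, k ≤ T → ∀ y ∈ X, R (z 1) / η + ∑ t ∈ Finset.Icc 1 k, G t (z t)
      - k * (η * L ^ 2 / 2) ≤ F (k + 1) y := by
    intro k
    induction k with
    | zero =>
      intro _ y hy
      have := hmin 1 h1T y hy
      simpa [hF] using this
    | succ k ih =>
      intro hk y hy
      have hkm : k + 1 ∈ Finset.Icc 1 T := Finset.mem_Icc.2 ⟨by omega, hk⟩
      have a := ih (by omega) _ (hz _ hkm).1
      have b := hnext _ hkm y hy
      rw [Finset.sum_Icc_succ_top (by omega)]
      push_cast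
      linarith
  have hsT : Real.sqrt (2 * T) ^ 2 = 2 * T := Real.sq_sqrt (by positivity)
  have hsρ : Real.sqrt ρ ^ 2 = ρ := Real.sq_sqrt hρ0
  constructor
  · intro y hy
    have a := hind T le_rfl y hy
    have b : ∑ t ∈ Finset.Icc 1 T, ℓ t (z t) - ∑ t ∈ Finset.Icc 1 T, ℓ t y
        ≤ ∑ t ∈ Finset.Icc 1 T, G t (z t) - ∑ t ∈ Finset.Icc 1 T, G t y := by
      rw [← Finset.sum_sub_distrib, ← Finset.sum_sub_distrib]
      exact Finset.sum_le_sum fun t ht => hGconv t ht y hy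
    have c : F (T + 1) y = ∑ t ∈ Finset.Icc 1 T, G t y + R y / η := by simp [hF]
    have d := div_le_div_of_nonneg_right (hRle y hy _ (hz 1 h1T).1) hηpos.le
    rw [sub_div] at d
    have e : Real.sqrt (8 * ρ * T) = 2 * (Real.sqrt ρ * Real.sqrt (2 * T)) := by
      rw [Real.sqrt_eq_iff_mul_self_eq (by positivity) (by positivity)]
      nlinarith
    have f1 : ρ / η = L * (Real.sqrt ρ * Real.sqrt (2 * T)) := by
      rw [hη]
      nth_rewrite 1 [← hsρ]
      field_simp
    have f2 : T * (η * L ^ 2 / 2) = L * (Real.sqrt ρ * Real.sqrt (2 * T)) / 4 := by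
      have hq : 0 < Real.sqrt (2 * T) := by positivity
      rw [hη]
      generalize Real.sqrt (2 * T) = q at hsT hq
      have hT2 : (T:ℝ) = q ^ 2 / 2 := by linarith
      rw [hT2]
      field_simp
      norm_num
    have f3 : 0 ≤ L * (Real.sqrt ρ * Real.sqrt (2 * T)) := by positivity
    rw [e]
    linarith
  · intro t ht
    rw [Finset.mem_Icc] at ht
    have m1 : t ∈ Finset.Icc 1 T := Finset.mem_Icc.2 ⟨ht.1, by omega⟩
    have m2 : t + 1 ∈ Finset.Icc 1 T := Finset.mem_Icc.2 ⟨by omega, by omega⟩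
    have a1 := hgrow t m1 _ (hz _ m2).1
    have a2 := hgrow _ m2 _ (hz _ m1).1
    have a3 := hGlip t m1 _ (hz _ m2).1
    rw [hstep t ht.1, hstep t ht.1] at a2
    have e : N (z (t + 1) - z t) = N (z t - z (t + 1)) := by
      rw [← hNneg, neg_sub]
    rw [e] at a1 a3
    have hu := hNnn (z t - z (t + 1))
    set u := N (z t - z (t + 1))
    have k1 : u ^ 2 / η ≤ L * u := by
      have : u ^ 2 / η = u ^ 2 / 2 / η + u ^ 2 / 2 / η := by ring
      linarith
    rw [div_le_iff₀ hηpos] at k1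
    have k2 : u ≤ L * η := by
      rcases hu.eq_or_lt with h | h
      · rw [← h]; positivity
      · refine le_of_mul_le_mul_left ?_ h
        linarith
    have k3 : L * η = Real.sqrt (ρ / (2 * T)) := by
      rw [Real.sqrt_div hρ0, hη]
      field_simp
    linarith
end

section
/- Let A, B ∈ S^d and K* ∈ S^d_{≤1}, and suppose C(K*) := (1 − ‖K*‖_{1→1})·A + B K* has a unique stationary distribution with finite mixing time τ* := t_mix(C(K*)), while t_mix(A) > 4·τ* (in particular this includes the case where A has no unique stationary distribution). Then ‖K*‖_{1→1} > 1/(96·τ*). -/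
open Finset

noncomputable section

/-- The ℓ¹ norm of a vector in `ℝ^d`. -/
def l1 {d : ℕ} (x : Fin d → ℝ) : ℝ := ∑ i, |x i|

/-- The probability simplex `Δ^d ⊆ ℝ^d`. -/
def simplex (d : ℕ) : Set (Fin d → ℝ) := {x | (∀ i, 0 ≤ x i) ∧ ∑ i, x i = 1}

/-- The scaled simplex `Δ^d_a := a · Δ^d`. -/
def scaledSimplex (d : ℕ) (a : ℝ) : Set (Fin d → ℝ) := {x | ∃ y ∈ simplex d, x = a • y}

/-- `I = ∪_{α ∈ [alb, aub]} Δ^d_α`, the set of valid controls. -/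
def ISet (d : ℕ) (alb aub : ℝ) : Set (Fin d → ℝ) :=
  {u | ∃ α ∈ Set.Icc alb aub, u ∈ scaledSimplex d α}

/-- A column-stochastic matrix: nonnegative entries, every column sums to 1. -/
def IsStochastic {d : ℕ} (M : Matrix (Fin d) (Fin d) ℝ) : Prop :=
  (∀ i j, 0 ≤ M i j) ∧ ∀ j, ∑ i, M i j = 1

/-- `S^d_a := a · S^d`, scaled column-stochastic matrices. -/
def scaledStochastic (d : ℕ) (a : ℝ) : Set (Matrix (Fin d) (Fin d) ℝ) :=
  {M | ∃ N, IsStochastic N ∧ M = a • N}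

/-- `S^d_{≤1} := ∪_{a ∈ [0,1]} a · S^d`. -/
def stochasticLeOne (d : ℕ) : Set (Matrix (Fin d) (Fin d) ℝ) :=
  {M | ∃ a ∈ Set.Icc (0:ℝ) 1, M ∈ scaledStochastic d a}

/-- The `1 → 1` operator norm `‖M‖_{1→1} = sup_{‖x‖₁ = 1} ‖Mx‖₁`. -/
def norm11 {d : ℕ} (M : Matrix (Fin d) (Fin d) ℝ) : ℝ :=
  sSup ((fun x => l1 (M.mulVec x)) '' {x : Fin d → ℝ | l1 x = 1})

/-- `X` has a unique stationary distribution. -/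
def hasUniqueStationary {d : ℕ} (X : Matrix (Fin d) (Fin d) ℝ) : Prop :=
  ∃! π : Fin d → ℝ, π ∈ simplex d ∧ X.mulVec π = π

-- The unique stationary distribution of `X` (junk value `0` if not unique).
open Classical in
def statDist {d : ℕ} (X : Matrix (Fin d) (Fin d) ℝ) : Fin d → ℝ :=
  if h : hasUniqueStationary X then h.exists.choose else 0

/-- `D_X(t) := sup_{p ∈ Δ^d} ‖X^t p − π‖₁`. -/
def Dmix {d : ℕ} (X : Matrix (Fin d) (Fin d) ℝ) (t : ℕ) : ℝ :=
  sSup ((fun p => l1 ((X ^ t).mulVec p - statDist X)) '' simplex d)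

/-- `t_mix(X, ε) := min {t : D_X(t) ≤ ε}`, as an extended natural number
(`⊤` if `X` has no unique stationary distribution or never mixes). -/
def tmix {d : ℕ} (X : Matrix (Fin d) (Fin d) ℝ) (ε : ℝ) : ℕ∞ :=
  sInf ((fun t : ℕ => (t : ℕ∞)) '' {t : ℕ | hasUniqueStationary X ∧ Dmix X t ≤ ε})

/-- `t_mix(X) ≤ r` (with the convention `t_mix(X) = t_mix(X, 1/4)`), for a real bound `r`. -/
def tmixLE {d : ℕ} (X : Matrix (Fin d) (Fin d) ℝ) (r : ℝ) : Prop :=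
  ∃ t : ℕ, (t : ℝ) ≤ r ∧ hasUniqueStationary X ∧ Dmix X t ≤ 1/4

/-- `C(K) := (1 − ‖K‖_{1→1}) · A + B K`. -/
def CK {d : ℕ} (A B K : Matrix (Fin d) (Fin d) ℝ) : Matrix (Fin d) (Fin d) ℝ :=
  (1 - norm11 K) • A + B * K

/-- `λ_{t,i} := γ_{t−i} ∏_{j=1}^{i−1} (1 − γ_{t−j})`. -/
def lam (γ : ℤ → ℝ) (t i : ℕ) : ℝ :=
  γ ((t : ℤ) - i) * ∏ j ∈ Finset.Ico 1 i, (1 - γ ((t : ℤ) - j))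

/-- `λ̄_{t,i} := ∏_{j=1}^{i} (1 − γ_{t−j})`. -/
def lamBar (γ : ℤ → ℝ) (t i : ℕ) : ℝ := ∏ j ∈ Finset.Icc 1 i, (1 - γ ((t : ℤ) - j))

/-- `λ_{t,0} := 1 − ∑_{i=1}^{H} λ_{t,i}`. -/
def lam0 (γ : ℤ → ℝ) (H t : ℕ) : ℝ := 1 - ∑ i ∈ Finset.Icc 1 H, lam γ t i

/-- The state trajectory of a simplex LDS under a given sequence of controls `u`:
`x_1` is the initial state and
`x_{t+1} = (1−γ_t)[(1−‖u_t‖₁) A x_t + B u_t] + γ_t w_t` for `t ≥ 1`. -/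
def traj {d : ℕ} (A B : Matrix (Fin d) (Fin d) ℝ) (γ : ℤ → ℝ) (w : ℤ → Fin d → ℝ)
    (x1 : Fin d → ℝ) (u : ℕ → Fin d → ℝ) : ℕ → Fin d → ℝ
  | 0 => x1
  | 1 => x1
  | t + 2 =>
      (1 - γ ((t : ℤ) + 1)) •
          ((1 - l1 (u (t + 1))) • A.mulVec (traj A B γ w x1 u (t + 1)) +
            B.mulVec (u (t + 1))) +
        γ ((t : ℤ) + 1) • w ((t : ℤ) + 1)

/-- The state trajectory of a simplex LDS under the linear policy `u_t = K x_t`. -/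
def trajK {d : ℕ} (A B : Matrix (Fin d) (Fin d) ℝ) (γ : ℤ → ℝ) (w : ℤ → Fin d → ℝ)
    (x1 : Fin d → ℝ) (K : Matrix (Fin d) (Fin d) ℝ) : ℕ → Fin d → ℝ
  | 0 => x1
  | 1 => x1
  | t + 2 =>
      (1 - γ ((t : ℤ) + 1)) •
          ((1 - l1 (K.mulVec (trajK A B γ w x1 K (t + 1)))) •
              A.mulVec (trajK A B γ w x1 K (t + 1)) +
            B.mulVec (K.mulVec (trajK A B γ w x1 K (t + 1)))) +
        γ ((t : ℤ) + 1) • w ((t : ℤ) + 1)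

/-- The disturbance-action control with parameters `(p, M^{[1:H]})`:
`u_s = λ_{s,0} p + ∑_{j=1}^H λ_{s,j} M^{[j]} w_{s−j}`. -/
def dacCtrl {d : ℕ} (γ : ℤ → ℝ) (w : ℤ → Fin d → ℝ) (H : ℕ) (p : Fin d → ℝ)
    (M : ℕ → Matrix (Fin d) (Fin d) ℝ) (s : ℕ) : Fin d → ℝ :=
  lam0 γ H s • p + ∑ j ∈ Finset.Icc 1 H, lam γ s j • (M j).mulVec (w ((s : ℤ) - j))

/-- Entropy of a sub-distribution `v ∈ Δ^d_{≤1}`. -/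
def Ent (d : ℕ) (v : Fin d → ℝ) : ℝ :=
  (1 - ∑ j, v j) * Real.log (1 / (1 - ∑ j, v j)) + ∑ j, v j * Real.log (1 / v j)

/-- The regularizer `Rgpc(p, M^{[1:H]}) = −Ent(p) − ∑_{h=1}^H ∑_{j=1}^d Ent(M^{[h]}_{·,j})`. -/
def Rgpc (d H : ℕ) (z : (Fin d → ℝ) × (ℕ → Matrix (Fin d) (Fin d) ℝ)) : ℝ :=
  -Ent d z.1 - ∑ h ∈ Finset.Icc 1 H, ∑ j, Ent d (fun i => z.2 h i j)

/-- The domain `X_{d,H,a,b} := ∪_{a' ∈ [a,b]} Δ^d_{a'} × (S^d_{a'})^H`. -/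
def Xgpc (d H : ℕ) (a b : ℝ) : Set ((Fin d → ℝ) × (ℕ → Matrix (Fin d) (Fin d) ℝ)) :=
  {z | ∃ a' ∈ Set.Icc a b, z.1 ∈ scaledSimplex d a' ∧
    ∀ h ∈ Finset.Icc 1 H, z.2 h ∈ scaledStochastic d a'}

/-- Euclidean inner product on the parameter space `ℝ^d × (ℝ^{d×d})^H`
(only the blocks `1 ≤ h ≤ H` count). -/
def iprod (d H : ℕ) (z y : (Fin d → ℝ) × (ℕ → Matrix (Fin d) (Fin d) ℝ)) : ℝ :=
  ∑ i, z.1 i * y.1 i + ∑ h ∈ Finset.Icc 1 H, ∑ i, ∑ j, z.2 h i j * y.2 h i j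

/-- The norm `‖(p, M^{[1:H]})‖_{d,H}` with
`‖(p,M)‖² = ‖p‖₁² + ∑_{h=1}^H ∑_{j=1}^d ‖M^{[h]}_{·,j}‖₁²`. -/
def normdH (d H : ℕ) (z : (Fin d → ℝ) × (ℕ → Matrix (Fin d) (Fin d) ℝ)) : ℝ :=
  Real.sqrt ((l1 z.1) ^ 2 + ∑ h ∈ Finset.Icc 1 H, ∑ j, (∑ i, |z.2 h i j|) ^ 2)

/-- The counterfactual loss `ℓ_t(p, M^{[1:H]}) = c_t(x_t(p,M^{[1:H]}), u_t(p,M^{[1:H]}))`. -/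
def lossGPC {d : ℕ} (A B : Matrix (Fin d) (Fin d) ℝ) (γ : ℤ → ℝ) (w : ℤ → Fin d → ℝ)
    (x1 : Fin d → ℝ) (cst : ℕ → (Fin d → ℝ) → (Fin d → ℝ) → ℝ) (H t : ℕ)
    (z : (Fin d → ℝ) × (ℕ → Matrix (Fin d) (Fin d) ℝ)) : ℝ :=
  cst t (traj A B γ w x1 (dacCtrl γ w H z.1 z.2) t) (dacCtrl γ w H z.1 z.2 t)

lemma l1_nonneg' {d : ℕ} (x : Fin d → ℝ) : 0 ≤ l1 x := Finset.sum_nonneg fun _ _ => abs_nonneg _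

lemma l1_add_le' {d : ℕ} (x y : Fin d → ℝ) : l1 (x + y) ≤ l1 x + l1 y := by
  unfold l1
  rw [← Finset.sum_add_distrib]
  exact Finset.sum_le_sum fun i _ => abs_add_le _ _

lemma l1_smul' {d : ℕ} (a : ℝ) (x : Fin d → ℝ) : l1 (a • x) = |a| * l1 x := by
  simp [l1, abs_mul, Finset.mul_sum]

lemma l1_neg' {d : ℕ} (x : Fin d → ℝ) : l1 (-x) = l1 x := by
  simp [l1]

lemma l1_sub_le' {d : ℕ} (x y : Fin d → ℝ) : l1 (x - y) ≤ l1 x + l1 y := by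
  rw [sub_eq_add_neg, ← l1_neg' y]
  exact l1_add_le' _ _

lemma l1_simplex {d : ℕ} {p : Fin d → ℝ} (hp : p ∈ simplex d) : l1 p = 1 := by
  rw [← hp.2]
  exact Finset.sum_congr rfl fun i _ => abs_of_nonneg (hp.1 i)

lemma stoch_sum {d : ℕ} {M : Matrix (Fin d) (Fin d) ℝ} (hM : IsStochastic M) (x : Fin d → ℝ) :
    ∑ i, M.mulVec x i = ∑ i, x i := by
  simp only [Matrix.mulVec, dotProduct]
  rw [Finset.sum_comm]
  refine Finset.sum_congr rfl fun j _ => ?_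
  rw [← Finset.sum_mul, hM.2 j, one_mul]

lemma stoch_abs {d : ℕ} {M : Matrix (Fin d) (Fin d) ℝ} (hM : IsStochastic M) (x : Fin d → ℝ)
    (i : Fin d) : |M.mulVec x i| ≤ M.mulVec (fun j => |x j|) i := by
  simp only [Matrix.mulVec, dotProduct]
  refine (Finset.abs_sum_le_sum_abs _ _).trans (le_of_eq ?_)
  refine Finset.sum_congr rfl fun j _ => ?_
  rw [abs_mul, abs_of_nonneg (hM.1 i j)]

lemma stoch_l1 {d : ℕ} {M : Matrix (Fin d) (Fin d) ℝ} (hM : IsStochastic M) (x : Fin d → ℝ) :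
    l1 (M.mulVec x) ≤ l1 x :=
  (Finset.sum_le_sum fun i _ => stoch_abs hM x i).trans (le_of_eq (stoch_sum hM _))

lemma stoch_simplex {d : ℕ} {M : Matrix (Fin d) (Fin d) ℝ} (hM : IsStochastic M) {p : Fin d → ℝ}
    (hp : p ∈ simplex d) : M.mulVec p ∈ simplex d := by
  refine ⟨fun i => ?_, ?_⟩
  · simp only [Matrix.mulVec, dotProduct]
    exact Finset.sum_nonneg fun j _ => mul_nonneg (hM.1 i j) (hp.1 j)
  · rw [stoch_sum hM, hp.2]

lemma stoch_mul {d : ℕ} {M N : Matrix (Fin d) (Fin d) ℝ} (hM : IsStochastic M)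
    (hN : IsStochastic N) : IsStochastic (M * N) := by
  refine ⟨fun i j => ?_, fun j => ?_⟩
  · rw [Matrix.mul_apply]
    exact Finset.sum_nonneg fun k _ => mul_nonneg (hM.1 i k) (hN.1 k j)
  · have := stoch_sum hM (fun k => N k j)
    rw [hN.2 j] at this
    simpa [Matrix.mul_apply, Matrix.mulVec, dotProduct] using this

lemma stoch_one {d : ℕ} : IsStochastic (1 : Matrix (Fin d) (Fin d) ℝ) := by
  refine ⟨fun i j => ?_, fun j => ?_⟩
  · rw [Matrix.one_apply]; split_ifs <;> norm_num
  · simp [Matrix.one_apply]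

lemma stoch_pow {d : ℕ} {M : Matrix (Fin d) (Fin d) ℝ} (hM : IsStochastic M) (t : ℕ) :
    IsStochastic (M ^ t) := by
  induction t with
  | zero => rw [pow_zero]; exact stoch_one
  | succ t ih => rw [pow_succ]; exact stoch_mul ih hM

/-- Perturbation of powers. -/
lemma pow_diff {d : ℕ} {M N : Matrix (Fin d) (Fin d) ℝ} (hM : IsStochastic M)
    (hN : IsStochastic N) (c : ℝ)
    (h : ∀ p ∈ simplex d, l1 (M.mulVec p - N.mulVec p) ≤ c) (t : ℕ) :
    ∀ p ∈ simplex d, l1 ((M ^ t).mulVec p - (N ^ t).mulVec p) ≤ t * c := by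
  induction t with
  | zero => intro p _; simp [l1]
  | succ t ih =>
    intro p hp
    have e : (M ^ (t+1)).mulVec p - (N ^ (t+1)).mulVec p
        = (M.mulVec ((M^t).mulVec p) - N.mulVec ((M^t).mulVec p))
          + N.mulVec ((M^t).mulVec p - (N^t).mulVec p) := by
      rw [pow_succ', pow_succ', Matrix.mulVec_sub, ← Matrix.mulVec_mulVec, ← Matrix.mulVec_mulVec]
      abel
    rw [e]
    have h1 := h _ (stoch_simplex (stoch_pow hM t) hp)
    have h2 := (stoch_l1 hN ((M^t).mulVec p - (N^t).mulVec p)).trans (ih p hp)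
    have h3 := l1_add_le' (M.mulVec ((M^t).mulVec p) - N.mulVec ((M^t).mulVec p))
          (N.mulVec ((M^t).mulVec p - (N^t).mulVec p))
    push_cast
    linarith

/-- Existence of a stationary distribution. -/
lemma exists_stat {d : ℕ} (i0 : Fin d) {M : Matrix (Fin d) (Fin d) ℝ} (hM : IsStochastic M) :
    ∃ p ∈ simplex d, M.mulVec p = p := by
  have hdet : (M - 1).det = 0 := by
    rw [← Matrix.det_transpose]
    refine Matrix.exists_mulVec_eq_zero_iff.mp ⟨fun _ => 1, ?_, ?_⟩
    · intro h; exact one_ne_zero (congrFun h i0)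
    · ext j
      simp [Matrix.mulVec, dotProduct, Finset.sum_sub_distrib, hM.2 j, Matrix.one_apply]
  obtain ⟨v, hv0, hv⟩ := Matrix.exists_mulVec_eq_zero_iff.mpr hdet
  have hv : M.mulVec v = v := by
    rw [Matrix.sub_mulVec, Matrix.one_mulVec] at hv
    exact sub_eq_zero.mp hv
  have hle : ∀ i ∈ (Finset.univ : Finset (Fin d)), |v i| ≤ M.mulVec (fun j => |v j|) i := by
    intro i _
    have := stoch_abs hM v i
    rwa [hv] at this
  have heq := (Finset.sum_eq_sum_iff_of_le hle).mp (stoch_sum hM _).symm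
  have hfix : M.mulVec (fun j => |v j|) = fun j => |v j| := by
    ext i; exact (heq i (Finset.mem_univ i)).symm
  have hpos : 0 < l1 v := by
    obtain ⟨i, hi⟩ := Function.ne_iff.mp hv0
    exact Finset.sum_pos' (fun _ _ => abs_nonneg _) ⟨i, Finset.mem_univ _, abs_pos.mpr hi⟩
  refine ⟨(l1 v)⁻¹ • fun j => |v j|, ⟨fun i => ?_, ?_⟩, ?_⟩
  · exact mul_nonneg (inv_nonneg.mpr hpos.le) (abs_nonneg _)
  · simp only [Pi.smul_apply, smul_eq_mul, ← Finset.mul_sum]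
    exact inv_mul_cancel₀ hpos.ne'
  · rw [Matrix.mulVec_smul, hfix]

/-- Contraction on zero-sum vectors. -/
lemma contract {d : ℕ} {M : Matrix (Fin d) (Fin d) ℝ} (c : ℝ)
    (h : ∀ p ∈ simplex d, ∀ q ∈ simplex d, l1 (M.mulVec p - M.mulVec q) ≤ c)
    (x : Fin d → ℝ) (hx : ∑ i, x i = 0) : l1 (M.mulVec x) ≤ c / 2 * l1 x := by
  set s := ∑ i, max (x i) 0 with hs
  have e1 : ∀ i, x i = max (x i) 0 - max (-x i) 0 := fun i => by
    rcases le_total (x i) 0 with h | h <;> simp [h]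
  have e2 : ∀ i, |x i| = max (x i) 0 + max (-x i) 0 := fun i => by
    rcases le_total (x i) 0 with h | h <;> simp [h, abs_of_nonneg, abs_of_nonpos]
  have s2 : ∑ i, max (-x i) 0 = s := by
    have : ∑ i, x i = s - ∑ i, max (-x i) 0 := by
      rw [hs, ← Finset.sum_sub_distrib]; exact Finset.sum_congr rfl fun i _ => e1 i
    linarith
  have s3 : l1 x = 2 * s := by
    have : l1 x = s + ∑ i, max (-x i) 0 := by
      rw [hs, ← Finset.sum_add_distrib]; exact Finset.sum_congr rfl fun i _ => e2 i
    linarith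
  have s0 : 0 ≤ s := Finset.sum_nonneg fun _ _ => le_max_right _ _
  rcases s0.eq_or_lt with hz | hpos
  · have hl : l1 x = 0 := by rw [s3, ← hz]; simp
    have hx0 : x = 0 := by
      ext i
      have := (Finset.sum_eq_zero_iff_of_nonneg (fun j _ => abs_nonneg (x j))).mp hl i
        (Finset.mem_univ i)
      simpa using this
    rw [hx0]; simp [l1]
  · have hp : (s⁻¹ • fun i => max (x i) 0) ∈ simplex d := by
      refine ⟨fun i => mul_nonneg (inv_nonneg.mpr s0) (le_max_right _ _), ?_⟩
      simp only [Pi.smul_apply, smul_eq_mul, ← Finset.mul_sum]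
      exact inv_mul_cancel₀ hpos.ne'
    have hq : (s⁻¹ • fun i => max (-x i) 0) ∈ simplex d := by
      refine ⟨fun i => mul_nonneg (inv_nonneg.mpr s0) (le_max_right _ _), ?_⟩
      simp only [Pi.smul_apply, smul_eq_mul, ← Finset.mul_sum]
      rw [s2]
      exact inv_mul_cancel₀ hpos.ne'
    have hxe : x = s • ((s⁻¹ • fun i => max (x i) 0) - (s⁻¹ • fun i => max (-x i) 0)) := by
      rw [← smul_sub, smul_smul, mul_inv_cancel₀ hpos.ne', one_smul]
      ext i; exact e1 i
    have hh := h _ hp _ hq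
    rw [← Matrix.mulVec_sub] at hh
    have : l1 (M.mulVec x) = s * l1 (M.mulVec ((s⁻¹ • fun i => max (x i) 0)
        - (s⁻¹ • fun i => max (-x i) 0))) := by
      conv_lhs => rw [hxe]
      rw [Matrix.mulVec_smul, l1_smul', abs_of_pos hpos]
    rw [this, s3]
    nlinarith

lemma norm11_scaled {d : ℕ} (i0 : Fin d) {N : Matrix (Fin d) (Fin d) ℝ} (hN : IsStochastic N)
    {a : ℝ} (ha : 0 ≤ a) : norm11 (a • N) = a := by
  have hs : (Pi.single i0 1 : Fin d → ℝ) ∈ simplex d := by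
    refine ⟨fun i => ?_, by simp⟩
    by_cases h : i = i0 <;> simp [Pi.single_apply, h]
  have : IsGreatest ((fun x => l1 ((a • N).mulVec x)) '' {x : Fin d → ℝ | l1 x = 1}) a := by
    refine ⟨⟨Pi.single i0 1, l1_simplex hs, ?_⟩, ?_⟩
    · simp only [Matrix.smul_mulVec, l1_smul', l1_simplex (stoch_simplex hN hs), abs_of_nonneg ha,
        mul_one]
    · rintro _ ⟨x, hx, rfl⟩
      have hx : l1 x = 1 := hx
      have := stoch_l1 hN x
      simp only [Matrix.smul_mulVec, l1_smul', abs_of_nonneg ha]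
      rw [hx] at this
      nlinarith
  exact this.csSup_eq

lemma statDist_spec {d : ℕ} {X : Matrix (Fin d) (Fin d) ℝ} (h : hasUniqueStationary X) :
    statDist X ∈ simplex d ∧ X.mulVec (statDist X) = statDist X := by
  unfold statDist
  rw [dif_pos h]
  exact h.exists.choose_spec

lemma pow_fix {d : ℕ} {X : Matrix (Fin d) (Fin d) ℝ} {p : Fin d → ℝ} (h : X.mulVec p = p) (t : ℕ) :
    (X ^ t).mulVec p = p := by
  induction t with
  | zero => simp
  | succ t ih => rw [pow_succ, ← Matrix.mulVec_mulVec, h, ih]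

/-- If `A, B ∈ S^d`, `K* ∈ S^d_{≤1}`, the closed-loop matrix
`C(K*) = (1 − ‖K*‖_{1→1})·A + B K*` has finite mixing time `τ* = t_mix(C(K*))`, and
`t_mix(A) > 4·τ*` (including the case where `A` has no unique stationary distribution,
i.e. `t_mix(A) = ⊤`), then `‖K*‖_{1→1} > 1/(96·τ*)`. -/
theorem mixing_policy_norm_lower_bound (d : ℕ) (A B K : Matrix (Fin d) (Fin d) ℝ)
    (hA : IsStochastic A) (hB : IsStochastic B)
    (hK : K ∈ stochasticLeOne d)
    (τs : ℕ) (hτ : tmix (CK A B K) (1 / 4) = (τs : ℕ∞))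
    (hAτ : 4 * (τs : ℕ∞) < tmix A (1 / 4)) :
    1 / (96 * (τs : ℝ)) < norm11 K := by
  classical
  by_contra hcon
  rw [not_lt] at hcon
  -- extract the mixing data of the closed loop
  have hne : ((fun t : ℕ => (t : ℕ∞)) ''
      {t : ℕ | hasUniqueStationary (CK A B K) ∧ Dmix (CK A B K) t ≤ 1 / 4}).Nonempty := by
    by_contra hemp
    rw [Set.not_nonempty_iff_eq_empty] at hemp
    unfold tmix at hτ
    rw [hemp, sInf_empty] at hτ
    exact absurd hτ (by simp)
  have hmem := csInf_mem hne
  change tmix (CK A B K) (1 / 4) ∈ _ at hmem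
  rw [hτ] at hmem
  obtain ⟨t, ⟨hu, hD⟩, ht⟩ := hmem
  have ht : t = τs := Nat.cast_injective (R := ℕ∞) ht
  subst ht
  obtain ⟨hπ, -⟩ := statDist_spec hu
  have hd : Nonempty (Fin d) := by
    by_contra hno
    rw [not_nonempty_iff] at hno
    have := hπ.2
    simp at this
  obtain ⟨i0⟩ := hd
  obtain ⟨a, ⟨ha0, ha1⟩, N, hN, rfl⟩ := hK
  have hna := norm11_scaled i0 hN ha0
  rw [hna] at hcon
  set C := CK A B (a • N) with hCdef
  have hCe : C = (1 - a) • A + a • (B * N) := by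
    rw [hCdef, CK, hna, Matrix.mul_smul]
  have hBN := stoch_mul hB hN
  have hC : IsStochastic C := by
    rw [hCe]
    refine ⟨fun i j => ?_, fun j => ?_⟩
    · simp only [Matrix.add_apply, Matrix.smul_apply, smul_eq_mul]
      exact add_nonneg (mul_nonneg (by linarith) (hA.1 i j)) (mul_nonneg ha0 (hBN.1 i j))
    · simp only [Matrix.add_apply, Matrix.smul_apply, smul_eq_mul, Finset.sum_add_distrib,
        ← Finset.mul_sum, hA.2 j, hBN.2 j]
      ring
  have hdiff : ∀ p ∈ simplex d, l1 (A.mulVec p - C.mulVec p) ≤ 2 * a := by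
    intro p hp
    have e : A.mulVec p - C.mulVec p = a • (A.mulVec p - (B * N).mulVec p) := by
      rw [hCe, Matrix.add_mulVec, Matrix.smul_mulVec, Matrix.smul_mulVec, smul_sub, sub_smul,
        one_smul]
      abel
    rw [e, l1_smul', abs_of_nonneg ha0]
    have h1 := l1_sub_le' (A.mulVec p) ((B * N).mulVec p)
    rw [l1_simplex (stoch_simplex hA hp), l1_simplex (stoch_simplex hBN hp)] at h1
    nlinarith
  have hat : (t : ℝ) * a ≤ 1 / 96 := by
    rcases Nat.eq_zero_or_pos t with h0 | h0
    · subst h0; norm_num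
    · have h0' : (0 : ℝ) < t := by exact_mod_cast h0
      rw [le_div_iff₀ (by positivity)] at hcon
      linarith
  have hpert : ∀ p ∈ simplex d, l1 ((A ^ (4 * t)).mulVec p - (C ^ (4 * t)).mulVec p) ≤ 1 / 12 := by
    intro p hp
    have := pow_diff hA hC _ hdiff (4 * t) p hp
    push_cast at this
    linarith
  have hDp : ∀ p ∈ simplex d, l1 ((C ^ t).mulVec p - statDist C) ≤ 1 / 4 := by
    intro p hp
    have hbdd : BddAbove ((fun p => l1 ((C ^ t).mulVec p - statDist C)) '' simplex d) := by
      refine ⟨2, ?_⟩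
      rintro _ ⟨q, hq, rfl⟩
      have h1 := l1_sub_le' ((C ^ t).mulVec q) (statDist C)
      rw [l1_simplex (stoch_simplex (stoch_pow hC t) hq), l1_simplex hπ] at h1
      exact h1.trans (by norm_num)
    exact le_trans (le_csSup hbdd ⟨p, hp, rfl⟩) hD
  have hpq : ∀ p ∈ simplex d, ∀ q ∈ simplex d,
      l1 ((C ^ t).mulVec p - (C ^ t).mulVec q) ≤ 1 / 2 := by
    intro p hp q hq
    have h1 := l1_sub_le' ((C ^ t).mulVec p - statDist C) ((C ^ t).mulVec q - statDist C)
    rw [sub_sub_sub_cancel_right] at h1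
    linarith [hDp p hp, hDp q hq]
  have hcontr := contract (1 / 2) hpq
  have hsum : ∀ x : Fin d → ℝ, ∑ i, x i = 0 → ∑ i, (C ^ t).mulVec x i = 0 := fun x hx => by
    rw [stoch_sum (stoch_pow hC t), hx]
  have hC4 : ∀ p ∈ simplex d, ∀ q ∈ simplex d,
      l1 ((C ^ (4 * t)).mulVec p - (C ^ (4 * t)).mulVec q) ≤ 1 / 128 := by
    intro p hp q hq
    rw [← Matrix.mulVec_sub]
    have hz : ∑ i, (p - q) i = 0 := by
      simp [Finset.sum_sub_distrib, hp.2, hq.2]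
    have hl := l1_sub_le' p q
    rw [l1_simplex hp, l1_simplex hq] at hl
    have e : (C ^ (4 * t)).mulVec (p - q)
        = (C ^ t).mulVec ((C ^ t).mulVec ((C ^ t).mulVec ((C ^ t).mulVec (p - q)))) := by
      simp only [Matrix.mulVec_mulVec, ← pow_add]
      congr 2
      ring
    rw [e]
    have z1 := hsum _ hz
    have z2 := hsum _ z1
    have z3 := hsum _ z2
    linarith [hcontr _ hz, hcontr _ z1, hcontr _ z2, hcontr _ z3]
  have hA4 : ∀ p ∈ simplex d, ∀ q ∈ simplex d,
      l1 ((A ^ (4 * t)).mulVec p - (A ^ (4 * t)).mulVec q) ≤ 1 / 4 := by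
    intro p hp q hq
    have e : (A ^ (4 * t)).mulVec p - (A ^ (4 * t)).mulVec q
        = (((A ^ (4 * t)).mulVec p - (C ^ (4 * t)).mulVec p)
          - ((A ^ (4 * t)).mulVec q - (C ^ (4 * t)).mulVec q))
          + ((C ^ (4 * t)).mulVec p - (C ^ (4 * t)).mulVec q) := by abel
    rw [e]
    refine (l1_add_le' _ _).trans ?_
    have h1 := l1_sub_le' ((A ^ (4 * t)).mulVec p - (C ^ (4 * t)).mulVec p)
      ((A ^ (4 * t)).mulVec q - (C ^ (4 * t)).mulVec q)
    linarith [hpert p hp, hpert q hq, hC4 p hp q hq]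
  have huA : hasUniqueStationary A := by
    obtain ⟨π, hπs, hπf⟩ := exists_stat i0 hA
    refine ⟨π, ⟨hπs, hπf⟩, ?_⟩
    rintro q ⟨hq, hqf⟩
    have hz : ∑ i, (q - π) i = 0 := by
      simp [Finset.sum_sub_distrib, hq.2, hπs.2]
    have h1 := contract (1 / 4) hA4 _ hz
    rw [Matrix.mulVec_sub, pow_fix hqf, pow_fix hπf] at h1
    have h2 := l1_nonneg' (q - π)
    have h3 : l1 (q - π) = 0 := by linarith
    ext i
    have := (Finset.sum_eq_zero_iff_of_nonneg (fun j _ => abs_nonneg ((q - π) j))).mp h3 i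
      (Finset.mem_univ i)
    have := abs_eq_zero.mp this
    simpa [sub_eq_zero] using this
  obtain ⟨hσ, hσf⟩ := statDist_spec huA
  have hDA : Dmix A (4 * t) ≤ 1 / 4 := by
    refine csSup_le ⟨_, statDist A, hσ, rfl⟩ ?_
    rintro _ ⟨p, hp, rfl⟩
    have := hA4 p hp _ hσ
    rwa [pow_fix hσf] at this
  have hle : tmix A (1 / 4) ≤ ((4 * t : ℕ) : ℕ∞) := sInf_le ⟨4 * t, ⟨huA, hDA⟩, rfl⟩
  push_cast at hle
  exact absurd hAτ (not_lt.mpr hle)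

end
end

section
/- Consider a simplex LDS with transition matrices A, B ∈ S^d, initial state x₁ ∈ Δ^d, noise strengths γ_t ∈ [0,1] and noise values w_t ∈ Δ^d, and let K ∈ S^d_{≤1}. If the controls are chosen as u_t := K x_t for all t, then for every 1 ≤ t ≤ T the state satisfies the closed-form identity x_t = ∑_{i=1}^{t} C(K)^{i−1} · λ_{t,i} · w_{t−i}, and the control satisfies u_t = ∑_{i=1}^t K·C(K)^{i−1} · λ_{t,i} · w_{t−i}. -/
open Finset

noncomputable section

lemma simplex_sum_mulVec {d : ℕ} {N : Matrix (Fin d) (Fin d) ℝ} (hN : IsStochastic N)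
    (y : Fin d → ℝ) : ∑ i, N.mulVec y i = ∑ j, y j := by
  simp only [Matrix.mulVec, dotProduct]
  rw [Finset.sum_comm]
  refine Finset.sum_congr rfl fun j _ => ?_
  rw [← Finset.sum_mul, hN.2 j, one_mul]

lemma simplex_mulVec_mem {d : ℕ} {N : Matrix (Fin d) (Fin d) ℝ} (hN : IsStochastic N)
    {y : Fin d → ℝ} (hy : y ∈ simplex d) : N.mulVec y ∈ simplex d := by
  refine ⟨fun i => ?_, ?_⟩
  · simp only [Matrix.mulVec, dotProduct]
    exact Finset.sum_nonneg fun j _ => mul_nonneg (hN.1 i j) (hy.1 j)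
  · rw [simplex_sum_mulVec hN, hy.2]

lemma simplex_l1 {d : ℕ} {y : Fin d → ℝ} (hy : y ∈ simplex d) : l1 y = 1 := by
  rw [l1, ← hy.2]
  exact Finset.sum_congr rfl fun i _ => abs_of_nonneg (hy.1 i)

lemma simplex_l1_smul {d : ℕ} {a : ℝ} (ha : 0 ≤ a) (y : Fin d → ℝ) :
    l1 (a • y) = a * l1 y := by
  simp [l1, abs_mul, abs_of_nonneg ha, Finset.mul_sum]

lemma simplex_l1_mulVec_le {d : ℕ} {N : Matrix (Fin d) (Fin d) ℝ} (hN : IsStochastic N)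
    (y : Fin d → ℝ) : l1 (N.mulVec y) ≤ l1 y := by
  have h := simplex_sum_mulVec hN (fun j => |y j|)
  unfold l1
  rw [← h]
  refine Finset.sum_le_sum fun i _ => ?_
  simp only [Matrix.mulVec, dotProduct]
  refine (Finset.abs_sum_le_sum_abs _ _).trans (le_of_eq ?_)
  exact Finset.sum_congr rfl fun j _ => by rw [abs_mul, abs_of_nonneg (hN.1 i j)]

lemma simplex_norm11 {d : ℕ} {N : Matrix (Fin d) (Fin d) ℝ} (hN : IsStochastic N)
    {a : ℝ} (ha : 0 ≤ a) {y : Fin d → ℝ} (hy : y ∈ simplex d) : norm11 (a • N) = a := by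
  refine IsGreatest.csSup_eq ⟨⟨y, simplex_l1 hy, ?_⟩, ?_⟩
  · simp only [Matrix.smul_mulVec]
    rw [simplex_l1_smul ha, simplex_l1 (simplex_mulVec_mem hN hy), mul_one]
  · rintro _ ⟨z, hz, rfl⟩
    simp only [Matrix.smul_mulVec]
    rw [simplex_l1_smul ha]
    have h1 := simplex_l1_mulVec_le hN z
    have h2 : l1 z = 1 := hz
    nlinarith

lemma simplex_convex {d : ℕ} {a b : ℝ} (ha : 0 ≤ a) (hb : 0 ≤ b) (hab : a + b = 1)
    {y z : Fin d → ℝ} (hy : y ∈ simplex d) (hz : z ∈ simplex d) :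
    a • y + b • z ∈ simplex d := by
  refine ⟨fun i => ?_, ?_⟩
  · have := hy.1 i
    have := hz.1 i
    simp only [Pi.add_apply, Pi.smul_apply, smul_eq_mul]
    positivity
  · simp only [Pi.add_apply, Pi.smul_apply, smul_eq_mul, Finset.sum_add_distrib,
      ← Finset.mul_sum, hy.2, hz.2, mul_one, hab]

lemma lam_succ_succ (γ : ℤ → ℝ) (t i : ℕ) (hi : 1 ≤ i) :
    lam γ (t + 1) (i + 1) = (1 - γ (t : ℤ)) * lam γ t i := by
  unfold lam
  rw [Finset.prod_Ico_eq_prod_range, Finset.prod_Ico_eq_prod_range]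
  obtain ⟨k, rfl⟩ : ∃ k, i = k + 1 := ⟨i - 1, by omega⟩
  simp only [Nat.add_sub_cancel]
  rw [Finset.prod_range_succ']
  have e : ∀ j : ℕ, ((t + 1 : ℕ) : ℤ) - ((1 + (j + 1) : ℕ) : ℤ) = (t : ℤ) - ((1 + j : ℕ) : ℤ) := by
    intro j; push_cast; ring
  have e2 : ((t + 1 : ℕ) : ℤ) - ((k + 1 + 1 : ℕ) : ℤ) = (t : ℤ) - ((k + 1 : ℕ) : ℤ) := by
    push_cast; ring
  have e3 : ((t + 1 : ℕ) : ℤ) - ((1 + 0 : ℕ) : ℤ) = (t : ℤ) := by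
    push_cast; ring
  simp only [e, e2, e3]
  ring

/-- Closed-form expression for the state and control of a simplex LDS under the linear
policy `u_t = K x_t`: for every `1 ≤ t ≤ T`,
`x_t = ∑_{i=1}^{t} λ_{t,i} · C(K)^{i−1} w_{t−i}` and
`u_t = ∑_{i=1}^{t} λ_{t,i} · K C(K)^{i−1} w_{t−i}`,
with the conventions `w₀ = x₁`, `γ₀ = 1`, and `w_s = 0` for `s < 0`. -/
theorem simplex_lds_linear_policy_closed_form (d T : ℕ)
    (A B K : Matrix (Fin d) (Fin d) ℝ)
    (hA : IsStochastic A) (hB : IsStochastic B) (hK : K ∈ stochasticLeOne d)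
    (x1 : Fin d → ℝ) (hx1 : x1 ∈ simplex d)
    (γ : ℤ → ℝ) (w : ℤ → Fin d → ℝ)
    (hγ : ∀ t : ℤ, 0 ≤ t → γ t ∈ Set.Icc (0 : ℝ) 1) (hγ0 : γ 0 = 1)
    (hw : ∀ t : ℤ, 1 ≤ t → w t ∈ simplex d) (hw0 : w 0 = x1)
    (hwneg : ∀ t : ℤ, t < 0 → w t = 0)
    (x : ℕ → Fin d → ℝ) (hxinit : x 1 = x1)
    (hdyn : ∀ t : ℕ, 1 ≤ t →
      x (t + 1) =
        (1 - γ (t : ℤ)) •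
            ((1 - l1 (K.mulVec (x t))) • A.mulVec (x t) + B.mulVec (K.mulVec (x t))) +
          γ (t : ℤ) • w (t : ℤ)) :
    ∀ t : ℕ, 1 ≤ t → t ≤ T →
      x t = (∑ i ∈ Finset.Icc 1 t, lam γ t i • ((CK A B K) ^ (i - 1)).mulVec (w ((t : ℤ) - i))) ∧
      K.mulVec (x t) =
        ∑ i ∈ Finset.Icc 1 t, lam γ t i • (K * (CK A B K) ^ (i - 1)).mulVec (w ((t : ℤ) - i)) := by
  obtain ⟨a, ⟨ha0, ha1⟩, N, hN, rfl⟩ := hK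
  have hnorm : norm11 (a • N) = a := simplex_norm11 hN ha0 hx1
  have hl1 : ∀ y ∈ simplex d, l1 ((a • N).mulVec y) = a := fun y hy => by
    rw [Matrix.smul_mulVec, simplex_l1_smul ha0, simplex_l1 (simplex_mulVec_mem hN hy), mul_one]
  have hmem : ∀ t : ℕ, 1 ≤ t → x t ∈ simplex d := by
    intro t ht
    induction t, ht using Nat.le_induction with
    | base => rw [hxinit]; exact hx1
    | succ t ht ih =>
      rw [hdyn t ht, hl1 _ ih, Matrix.smul_mulVec, Matrix.mulVec_smul]
      have hg := hγ t (by omega)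
      refine simplex_convex (by linarith [hg.2]) hg.1 (by ring) ?_ (hw t (by omega))
      exact simplex_convex (by linarith) ha0 (by ring) (simplex_mulVec_mem hA ih)
        (simplex_mulVec_mem hB (simplex_mulVec_mem hN ih))
  have hrec : ∀ t : ℕ, 1 ≤ t → x (t + 1) =
      (1 - γ (t : ℤ)) • (CK A B (a • N)).mulVec (x t) + γ (t : ℤ) • w (t : ℤ) := by
    intro t ht
    rw [hdyn t ht, hl1 _ (hmem t ht), CK, hnorm, Matrix.add_mulVec, Matrix.smul_mulVec (1 - a) A,
      Matrix.mulVec_mulVec]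
  generalize CK A B (a • N) = C at hrec ⊢
  generalize a • N = K at *
  intro t ht _
  have key : x t = ∑ i ∈ Finset.Icc 1 t, lam γ t i • (C ^ (i - 1)).mulVec (w ((t : ℤ) - i)) := by
    clear * - hrec ht hxinit hγ0 hw0
    induction t, ht using Nat.le_induction with
    | base => simp [lam, hγ0, hw0, hxinit]
    | succ t ht ih =>
      rw [hrec t ht, ← Finset.add_sum_Ioc_eq_sum_Icc (by omega : 1 ≤ t + 1), add_comm]
      congr 1
      · simp [lam]
      · have hI : Finset.Ioc 1 (t + 1) = (Finset.Icc 1 t).image (· + 1) := by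
          ext j
          simp only [Finset.mem_Ioc, Finset.mem_image, Finset.mem_Icc]
          constructor
          · intro h; exact ⟨j - 1, by omega, by omega⟩
          · rintro ⟨i, h, rfl⟩; omega
        rw [hI, Finset.sum_image (by intro i _ j _ h; simpa using h), ih, Matrix.mulVec_sum,
          Finset.smul_sum]
        refine Finset.sum_congr rfl fun i hi => ?_
        have hi1 := (Finset.mem_Icc.mp hi).1
        rw [lam_succ_succ γ t i hi1, Matrix.mulVec_smul, smul_smul, Matrix.mulVec_mulVec,
          ← pow_succ', Nat.sub_add_cancel hi1, Nat.add_sub_cancel]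
        congr 3
        push_cast; ring
  refine ⟨key, ?_⟩
  conv_lhs => rw [key]
  rw [Matrix.mulVec_sum]
  refine Finset.sum_congr rfl fun i _ => ?_
  rw [Matrix.mulVec_smul, Matrix.mulVec_mulVec]

end
end

section
/- Let β ≥ 2, let T be an even positive integer, and let (x_t)_{t=T/2+1}^{T} and (u_t)_{t=T/2+1}^{T−1} be real sequences satisfying x_{t+1} = x_t − (β/T)·u_t for all T/2 < t < T. Then ∑_{t=T/2+1}^{T} |x_t| + ∑_{t=T/2+1}^{T−1} |u_t| ≥ (T/(2β))·|x_{T/2+1}|. -/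
open Finset

/-- Trajectory-cost lower bound in the lower bound for online control of marginally
stable LDSs: in the one-dimensional system `x_{t+1} = x_t − (β/T)·u_t` (for
`T/2 < t < T`), any trajectory pays second-half cost at least `(T/(2β))·|x_{T/2+1}|`. -/
theorem trajectory_cost_lower_bound_marginal_lds (T : ℕ) (hT : 0 < T) (hTeven : Even T)
    (β : ℝ) (hβ : 2 ≤ β) (x u : ℕ → ℝ)
    (hdyn : ∀ t : ℕ, T / 2 < t → t < T → x (t + 1) = x t - (β / T) * u t) :
    (T / (2 * β)) * |x (T / 2 + 1)| ≤
      (∑ t ∈ Finset.Icc (T / 2 + 1) T, |x t|) +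
        ∑ t ∈ Finset.Icc (T / 2 + 1) (T - 1), |u t| := by
  obtain ⟨n, rfl⟩ := hTeven
  have hn : (n + n) / 2 = n := by omega
  rw [hn] at hdyn ⊢
  have hn0 : 0 < n := by omega
  have hnR : (0 : ℝ) < n := by exact_mod_cast hn0
  have hβ0 : 0 < β := by linarith
  set c : ℝ := β / ((n + n : ℕ) : ℝ) with hc
  have hc0 : 0 ≤ c := by positivity
  have hcn : (n : ℝ) * c = β / 2 := by
    rw [hc]; push_cast; field_simp; norm_num
  set U := ∑ t ∈ Finset.Icc (n + 1) (n + n - 1), |u t| with hU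
  set S := ∑ t ∈ Finset.Icc (n + 1) (n + n), |x t| with hS
  have hS0 : 0 ≤ S := Finset.sum_nonneg fun _ _ => abs_nonneg _
  have key : ∀ j : ℕ, j < n →
      |x (n + 1)| ≤ |x (n + 1 + j)| + c * ∑ i ∈ Finset.Ico (n + 1) (n + 1 + j), |u i| := by
    intro j
    induction j with
    | zero => intro _; simp
    | succ j ih =>
      intro hj
      have h1 := ih (by omega)
      have h2 := hdyn (n + 1 + j) (by omega) (by omega)
      have h3 : x (n + 1 + j) = x (n + 1 + (j + 1)) + c * u (n + 1 + j) := by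
        rw [← add_assoc, h2]; ring
      have h4 := abs_add_le (x (n + 1 + (j + 1))) (c * u (n + 1 + j))
      rw [← h3, abs_mul, abs_of_nonneg hc0] at h4
      rw [← add_assoc (n + 1) j 1, Finset.sum_Ico_succ_top (by omega), mul_add]
      rw [← add_assoc (n + 1) j 1] at h4
      linarith
  have key2 : ∀ t ∈ Finset.Icc (n + 1) (n + n), |x (n + 1)| - c * U ≤ |x t| := by
    intro t ht
    rw [Finset.mem_Icc] at ht
    obtain ⟨j, rfl⟩ := Nat.exists_eq_add_of_le ht.1
    have h1 := key j (by omega)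
    have h2 : ∑ i ∈ Finset.Ico (n + 1) (n + 1 + j), |u i| ≤ U := by
      apply Finset.sum_le_sum_of_subset_of_nonneg
      · intro i hi
        rw [Finset.mem_Ico] at hi
        rw [Finset.mem_Icc]
        omega
      · intro _ _ _; exact abs_nonneg _
    have h3 := mul_le_mul_of_nonneg_left h2 hc0
    linarith
  have h5 := Finset.card_nsmul_le_sum _ _ _ key2
  have h6 : (Finset.Icc (n + 1) (n + n)).card = n := by simp
  rw [h6, nsmul_eq_mul, mul_sub, ← mul_assoc, hcn, ← hS] at h5
  have h7 : ((n + n : ℕ) : ℝ) / (2 * β) * |x (n + 1)| = (n * |x (n + 1)|) / β := by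
    push_cast; field_simp; ring
  rw [h7, div_le_iff₀ hβ0]
  have h8 : 0 ≤ U := Finset.sum_nonneg fun _ _ => abs_nonneg _
  nlinarith [mul_nonneg hβ0.le h8, mul_le_mul_of_nonneg_right hβ hS0]
end

section
/- Let β ≥ 1, let T be an even positive integer, and let (a_t)_{t=T/2+1}^{T} be a real sequence with a_t ∈ [0,1] for all t and |a_{t+1} − a_t| ≤ 2β/T for all T/2 < t < T. Then ∑_{t=T/2+1}^{T} |a_t − 1/2| ≥ (T/(8β))·(a_{T/2+1} − 1/2)² − 1. -/
open Finset

/-- Trajectory-cost lower bound in the lower bound for online control of simplex LDSs: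
if `a_t ∈ [0,1]` on the second half of the horizon and consecutive values change by at
most `2β/T`, then `∑_{t=T/2+1}^{T} |a_t − 1/2| ≥ (T/(8β))·(a_{T/2+1} − 1/2)² − 1`. -/
theorem trajectory_cost_lower_bound_simplex_lds (T : ℕ) (hT : 0 < T) (hTeven : Even T)
    (β : ℝ) (hβ : 1 ≤ β) (a : ℕ → ℝ)
    (ha : ∀ t ∈ Finset.Icc (T / 2 + 1) T, a t ∈ Set.Icc (0 : ℝ) 1)
    (hstep : ∀ t : ℕ, T / 2 < t → t < T → |a (t + 1) - a t| ≤ 2 * β / T) :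
    (T / (8 * β)) * (a (T / 2 + 1) - 1 / 2) ^ 2 - 1 ≤
      ∑ t ∈ Finset.Icc (T / 2 + 1) T, |a t - 1 / 2| := by
  obtain ⟨n, rfl⟩ := hTeven
  have hn : 0 < n := by omega
  have hh : (n + n) / 2 = n := by omega
  rw [hh] at *
  have hnR : (0 : ℝ) < n := by exact_mod_cast hn
  have hβ0 : 0 < β := by linarith
  obtain ⟨d, hd⟩ : ∃ d : ℝ, d = 2 * β / ((n + n : ℕ) : ℝ) := ⟨_, rfl⟩
  rw [← hd] at hstep
  have hdn : d * n = β := by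
    rw [hd]; push_cast; field_simp; ring
  have hd0 : 0 < d := by
    rw [hd]; push_cast; positivity
  obtain ⟨b, hb⟩ : ∃ b : ℝ, b = |a (n + 1) - 1 / 2| := ⟨_, rfl⟩
  have hb0 : 0 ≤ b := by rw [hb]; positivity
  have hb1 : b ≤ 1 / 2 := by
    have h := ha (n + 1) (by simp; omega)
    rw [hb, abs_le]
    constructor <;> linarith [h.1, h.2]
  have hlin : ∀ i : ℕ, i < n → b - i * d ≤ |a (n + 1 + i) - 1 / 2| := by
    intro i
    induction i with
    | zero => intro _; simp [hb]
    | succ i ih =>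
      intro hi
      have h1 := ih (by omega)
      have h2 := hstep (n + 1 + i) (by omega) (by omega)
      have h3 := abs_sub_abs_le_abs_sub (a (n + 1 + i) - 1 / 2) (a (n + 1 + i + 1) - 1 / 2)
      have h4 : |a (n + 1 + i) - 1 / 2 - (a (n + 1 + i + 1) - 1 / 2)|
          = |a (n + 1 + i + 1) - a (n + 1 + i)| := by
        rw [← abs_neg]; congr 1; ring
      rw [← add_assoc]
      push_cast
      linarith
  have hsum : ∀ m : ℕ, ∑ i ∈ Finset.range m, (b - i * d) = m * b - d * (m * (m - 1)) / 2 := by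
    intro m
    induction m with
    | zero => simp
    | succ m ih => rw [Finset.sum_range_succ, ih]; push_cast; ring
  obtain ⟨m, hm⟩ : ∃ m : ℕ, m = ⌈b / d⌉₊ := ⟨_, rfl⟩
  have hm1 : b / d ≤ m := by rw [hm]; exact Nat.le_ceil _
  have hm2 : (m : ℝ) < b / d + 1 := by rw [hm]; exact Nat.ceil_lt_add_one (by positivity)
  have hmn : m ≤ n := by
    rw [hm, Nat.ceil_le, div_le_iff₀ hd0]; linarith
  have hS : ∑ t ∈ Finset.Icc (n + 1) (n + n), |a t - 1 / 2|
      = ∑ i ∈ Finset.range n, |a (n + 1 + i) - 1 / 2| := by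
    have : Finset.Icc (n + 1) (n + n) = Finset.Ico (n + 1) (n + n + 1) := by
      ext t; simp only [Finset.mem_Icc, Finset.mem_Ico]; omega
    rw [this, Finset.sum_Ico_eq_sum_range]
    congr 2; omega
  have h5 : ∑ i ∈ Finset.range m, (b - i * d) ≤ ∑ i ∈ Finset.range n, |a (n + 1 + i) - 1 / 2| := by
    refine (Finset.sum_le_sum (fun i hi => hlin i ?_)).trans
      (Finset.sum_le_sum_of_subset_of_nonneg (Finset.range_mono hmn) (fun _ _ _ => abs_nonneg _))
    have := Finset.mem_range.1 hi
    omega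
  rw [hsum] at h5
  rw [hS]
  have hsq : (a (n + 1) - 1 / 2) ^ 2 = b ^ 2 := by rw [hb, sq_abs]
  have hc : (((n + n : ℕ) : ℝ) / (8 * β)) * b ^ 2 = b / d * b / 4 := by
    rw [← hdn]; push_cast; field_simp; ring
  rw [hsq, hc]
  have h6 : d * (m - 1) ≤ b := by
    have : (m : ℝ) - 1 ≤ b / d := by linarith
    rw [le_div_iff₀ hd0] at this; linarith
  have h7 : (m : ℝ) * (d * (m - 1)) ≤ m * b := mul_le_mul_of_nonneg_left h6 (by positivity)
  have h8 : b / d * b ≤ m * b := mul_le_mul_of_nonneg_right hm1 hb0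
  have h9 : 0 ≤ b / d * b := by positivity
  linarith
end
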